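/- Let n ≥ 2 and let f ∈ T_n be an element of finite order. Then there exists a standard n-adic subdivision P of the circle ℝ/ℤ such that f maps the set of endpoints of the intervals of P bijectively onto itself and f is affine on each interval of P. -/

import Mathlib

noncomputable section

namespace ThompsonPaper

/-- The circle `ℝ/ℤ`. -/
abbrev Circle : Type := AddCircle (1 : ℝ)

/-- Homeomorphisms of a topological space form a group under composition,
with `(f * g) x = f (g x)`. -/
instance homeoGroup {α : Type*} [TopologicalSpace α] : Group (α ≃ₜ α) where
  mul f g := g.trans f
  one := Homeomorph.refl α
  inv := Homeomorph.symm
  mul_assoc _ _ _ := Homeomorph.ext fun _ => rfl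
  one_mul _ := Homeomorph.ext fun _ => rfl
  mul_one _ := Homeomorph.ext fun _ => rfl
  inv_mul_cancel f := Homeomorph.ext fun x => f.symm_apply_apply x

/-- `x` is an `n`-adic rational: `x = a / n ^ k` with `a` an integer, `k` a natural number. -/
def IsNAdic (n : ℕ) (x : ℝ) : Prop := ∃ a : ℤ, ∃ k : ℕ, x = (a : ℝ) / (n : ℝ) ^ k

/-- The set of `n`-adic points of the circle. -/
def nAdicPoints (n : ℕ) : Set Circle := { p | ∃ x : ℝ, IsNAdic n x ∧ p = (x : Circle) }

/-- `F : ℝ → ℝ` is a lift of the circle map `f`. -/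
def IsLift (f : Circle ≃ₜ Circle) (F : ℝ → ℝ) : Prop :=
  ∀ x : ℝ, f (x : Circle) = ((F x : ℝ) : Circle)

/-- `F : ℝ → ℝ` commutes with translation by `1` and is piecewise affine with finitely
many breakpoints (modulo `1`), all breakpoints at `n`-adic rationals, and with the slope
of every affine piece an integer power of `n`. -/
def PiecewiseNAffine (n : ℕ) (F : ℝ → ℝ) : Prop :=
  (∀ x : ℝ, F (x + 1) = F x + 1) ∧
  ∃ m : ℕ, ∃ t : ℕ → ℝ, ∃ slope : ℕ → ℤ, ∃ c : ℕ → ℝ,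
    0 < m ∧ t 0 = 0 ∧ t m = 1 ∧
    (∀ i, i < m → t i < t (i + 1)) ∧
    (∀ i, i ≤ m → IsNAdic n (t i)) ∧
    (∀ i, i < m → ∀ x ∈ Set.Icc (t i) (t (i + 1)),
      F x = (n : ℝ) ^ (slope i) * x + c i)

/-- Membership in Thompson's group `T_n`: an orientation-preserving homeomorphism of the
circle `ℝ/ℤ` mapping the set of `n`-adic points onto itself, which is piecewise affine
with finitely many breakpoints, all breakpoints at `n`-adic points, and all slopes integer
powers of `n`.  (Orientation preservation and the piecewise affine structure are expressed
through a strictly increasing lift.) -/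
def InT (n : ℕ) (f : Circle ≃ₜ Circle) : Prop :=
  f '' nAdicPoints n = nAdicPoints n ∧
  ∃ F : ℝ → ℝ, StrictMono F ∧ IsLift f F ∧ PiecewiseNAffine n F

/-- Thompson's group `T_n`, as a set of circle homeomorphisms. -/
def TnSet (n : ℕ) : Set (Circle ≃ₜ Circle) := { f | InT n f }

/-- `IsStdSubdiv n k P` : `P` is the (finite) set of left endpoints of the intervals of a
standard `n`-adic subdivision of the circle `ℝ/ℤ` obtained from the trivial partition
`{[0,1)}` by `k` subdivision steps, each step replacing one interval by the `n` equal
subintervals it comprises. -/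
inductive IsStdSubdiv (n : ℕ) : ℕ → Finset ℝ → Prop
  | base : IsStdSubdiv n 0 {0}
  | step (k : ℕ) (P : Finset ℝ) (a b : ℝ) (hP : IsStdSubdiv n k P) (ha : a ∈ P)
      (hb : b ∈ insert (1 : ℝ) P) (hab : a < b)
      (hmin : ∀ c ∈ insert (1 : ℝ) P, a < c → b ≤ c) :
      IsStdSubdiv n (k + 1) (P ∪ (Finset.range n).image (fun j : ℕ => a + j * (b - a) / n))

/-- `b` is the right endpoint of the interval with left endpoint `a` of the subdivision
with set of left endpoints `P` (i.e. the successor of `a` in `P ∪ {1}`). -/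
def IsNext (P : Finset ℝ) (a b : ℝ) : Prop :=
  b ∈ insert (1 : ℝ) P ∧ a < b ∧ ∀ c ∈ insert (1 : ℝ) P, a < c → b ≤ c

/-- `f` is affine on each interval of the subdivision of the circle whose set of left
endpoints is `P`. -/
def AffineOnParts (P : Finset ℝ) (f : Circle ≃ₜ Circle) : Prop :=
  ∀ a ∈ P, ∀ b : ℝ, IsNext P a b →
    ∃ s c : ℝ, ∀ x ∈ Set.Icc a b, f (x : Circle) = ((s * x + c : ℝ) : Circle)

/-- The set of endpoints of the subdivision of the circle whose set of left endpoints is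
`P`, viewed inside the circle. -/
def circlePts (P : Finset ℝ) : Set Circle := (fun x : ℝ => (x : Circle)) '' ↑P

/-- Parametrisation of a standard interval. -/
def phi (n : ℕ) (a : ℤ) (k : ℕ) (x : ℝ) : ℝ := ((a : ℝ) + x) / (n : ℝ) ^ k

/-- `G` maps one standard interval affinely onto another one. -/
def Rel (n : ℕ) (G : ℝ → ℝ) (a : ℤ) (k : ℕ) (a' : ℤ) (k' : ℕ) : Prop :=
  ∀ x ∈ Set.Icc (0 : ℝ) 1, G (phi n a k x) = phi n a' k' x

/-- Standard intervals on which all iterates are good. -/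
def Good (n : ℕ) (F : ℝ → ℝ) (a : ℤ) (k : ℕ) : Prop :=
  ∀ i : ℕ, ∃ a' k', Rel n F^[i] a k a' k'

/-- The parent (if any) is not good. -/
def NoPar (n : ℕ) (F : ℝ → ℝ) (a : ℤ) (k : ℕ) : Prop :=
  ∀ (a0 : ℤ) (k0 : ℕ) (j : ℕ), j < n → a = n * a0 + j → k = k0 + 1 → ¬ Good n F a0 k0

/-- Deep intervals are mapped affinely. -/
def Deep (n : ℕ) (G : ℝ → ℝ) : Prop :=
  ∃ C : ℕ, ∀ k, C ≤ k → ∀ a, ∃ a' k', k ≤ k' + C ∧ Rel n G a k a' k'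

lemma phi_child (n : ℕ) (hn : 2 ≤ n) (a : ℤ) (k j : ℕ) (x : ℝ) :
    phi n (n * a + j) (k + 1) x = phi n a k ((j + x) / n) := by
  have : (n : ℝ) ≠ 0 := by positivity
  unfold phi
  push_cast
  field_simp
  try ring

lemma phi_add (n : ℕ) (hn : 2 ≤ n) (a z : ℤ) (k : ℕ) (x : ℝ) :
    phi n (a + z * n ^ k) k x = phi n a k x + z := by
  have : (n : ℝ) ≠ 0 := by positivity
  unfold phi
  push_cast
  field_simp
  try ring

lemma child_mem (n : ℕ) (hn : 2 ≤ n) (j : ℕ) (hj : j < n) (x : ℝ) (hx : x ∈ Set.Icc (0 : ℝ) 1) :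
    ((j : ℝ) + x) / n ∈ Set.Icc (0 : ℝ) 1 := by
  have h0 : (0 : ℝ) < n := by positivity
  have h1 : (j : ℝ) + 1 ≤ n := by exact_mod_cast hj
  obtain ⟨hx0, hx1⟩ := hx
  refine ⟨by positivity, ?_⟩
  rw [div_le_one h0]; linarith

lemma Rel.child {n : ℕ} (hn : 2 ≤ n) {G : ℝ → ℝ} {a k a' k'} (h : Rel n G a k a' k')
    (j : ℕ) (hj : j < n) : Rel n G (n * a + j) (k + 1) (n * a' + j) (k' + 1) := by
  intro x hx
  rw [phi_child n hn, phi_child n hn]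
  exact h _ (child_mem n hn j hj x hx)

lemma Good.child {n : ℕ} (hn : 2 ≤ n) {F : ℝ → ℝ} {a k} (h : Good n F a k)
    (j : ℕ) (hj : j < n) : Good n F (n * a + j) (k + 1) := by
  intro i
  obtain ⟨a', k', h⟩ := h i
  exact ⟨_, _, h.child hn j hj⟩

lemma phi_inj (n : ℕ) (hn : 2 ≤ n) {a a' : ℤ} {k k' : ℕ}
    (h : ∀ x ∈ Set.Icc (0 : ℝ) 1, phi n a k x = phi n a' k' x) : a = a' ∧ k = k' := by
  have hn0 : (0 : ℝ) < n := by positivity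
  have h0 := h 0 (by simp)
  have h1 := h 1 (by simp)
  unfold phi at h0 h1
  have e : (1 : ℝ) / (n : ℝ) ^ k = 1 / (n : ℝ) ^ k' := by
    rw [add_div, add_div] at h0 h1
    simp only [zero_div, add_zero] at h0
    linarith
  have e2 : (n : ℝ) ^ k = (n : ℝ) ^ k' := by
    simpa using e
  have hk : k = k' := by
    have : n ^ k = n ^ k' := by exact_mod_cast e2
    exact Nat.pow_right_injective hn this
  subst hk
  refine ⟨?_, rfl⟩
  have : (0 : ℝ) < (n : ℝ) ^ k := by positivity
  field_simp at h0
  simp at h0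
  exact_mod_cast h0

lemma iter_add_int {F : ℝ → ℝ} (hF : ∀ x, F (x + 1) = F x + 1) (i : ℕ) (x : ℝ) (z : ℤ) :
    F^[i] (x + z) = F^[i] x + z := by
  have nat : ∀ (m : ℕ) x, F (x + m) = F x + m := by
    intro m
    induction m with
    | zero => simp
    | succ m ih => intro x; push_cast; rw [← add_assoc, hF, ih]; ring
  have one : ∀ x (z : ℤ), F (x + z) = F x + z := by
    intro x z
    obtain ⟨m, rfl | rfl⟩ := z.eq_nat_or_neg
    · simpa using nat m x
    · have := nat m (x + -(m : ℝ))
      simp at this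
      push_cast
      linarith
  induction i generalizing x with
  | zero => simp
  | succ i ih => rw [Function.iterate_succ_apply, one, ih, Function.iterate_succ_apply]

lemma Rel.add {n : ℕ} (hn : 2 ≤ n) {F : ℝ → ℝ} (hF : ∀ x, F (x + 1) = F x + 1) {i a k a' k'}
    (h : Rel n F^[i] a k a' k') (z : ℤ) :
    Rel n F^[i] (a + z * n ^ k) k (a' + z * n ^ k') k' := by
  intro x hx
  rw [phi_add n hn, phi_add n hn, iter_add_int hF, h x hx]

lemma Good.add {n : ℕ} (hn : 2 ≤ n) {F : ℝ → ℝ} (hF : ∀ x, F (x + 1) = F x + 1) {a k}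
    (h : Good n F a k) (z : ℤ) : Good n F (a + z * n ^ k) k := by
  intro i
  obtain ⟨a', k', h⟩ := h i
  exact ⟨_, _, h.add hn hF z⟩

lemma NoPar.add {n : ℕ} (hn : 2 ≤ n) {F : ℝ → ℝ} (hF : ∀ x, F (x + 1) = F x + 1) {a k}
    (h : NoPar n F a k) (z : ℤ) : NoPar n F (a + z * n ^ k) k := by
  rintro a0 k0 j hj e rfl hg
  refine h (a0 + (-z) * n ^ k0) k0 j hj ?_ rfl (hg.add hn hF (-z))
  rw [pow_succ] at e
  linear_combination e

lemma Good.image {n : ℕ} {F : ℝ → ℝ} {a k a' k'} (m : ℕ) (h : Good n F a k)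
    (hr : Rel n F^[m] a k a' k') : Good n F a' k' := by
  intro i
  obtain ⟨b, l, hb⟩ := h (i + m)
  refine ⟨b, l, fun x hx => ?_⟩
  rw [← hr x hx, ← Function.iterate_add_apply, hb x hx]

lemma NoPar.image {n : ℕ} (hn : 2 ≤ n) {F : ℝ → ℝ} (hF : ∀ x, F (x + 1) = F x + 1)
    {q : ℕ} {p : ℤ} (hq : ∀ x, F^[q + 1] x = x + p) {a k a' k'} (h : NoPar n F a k)
    (hr : Rel n F a k a' k') : NoPar n F a' k' := by
  rintro a0 k0 j hj rfl rfl hg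
  obtain ⟨b, l, hb⟩ := hg q
  have hgb := hg.image q hb
  have hc := hb.child hn j hj
  have key : a + p * n ^ k = n * b + j ∧ k = l + 1 := by
    apply phi_inj n hn
    intro x hx
    rw [← hc x hx, ← hr x hx, ← Function.iterate_succ_apply, hq, phi_add n hn]
  obtain ⟨e, rfl⟩ := key
  exact (h.add hn hF p) b l j hj e rfl hgb

lemma Deep.comp {n : ℕ} {G H : ℝ → ℝ} (hG : Deep n G) (hH : Deep n H) : Deep n (G ∘ H) := by
  obtain ⟨C, hC⟩ := hG
  obtain ⟨D, hD⟩ := hH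
  refine ⟨C + D, fun k hk a => ?_⟩
  obtain ⟨a', k', h1, h2⟩ := hD k (by omega) a
  obtain ⟨b, l, h3, h4⟩ := hC k' (by omega) a'
  refine ⟨b, l, by omega, fun x hx => ?_⟩
  rw [Function.comp_apply, h2 x hx, h4 x hx]

lemma Deep.iter {n : ℕ} {F : ℝ → ℝ} (hF : Deep n F) (i : ℕ) : Deep n F^[i] := by
  induction i with
  | zero => exact ⟨0, fun k _ a => ⟨a, k, by simp, fun x _ => rfl⟩⟩
  | succ i ih => rw [Function.iterate_succ]; exact ih.comp hF

lemma exists_level {n : ℕ} (hn : 2 ≤ n) {F : ℝ → ℝ} (hF : ∀ x, F (x + 1) = F x + 1)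
    {q : ℕ} {p : ℤ} (hq : ∀ x, F^[q + 1] x = x + p) (hD : Deep n F) :
    ∃ K, ∀ a, Good n F a K := by
  choose C hC using fun i => hD.iter i
  refine ⟨∑ i ∈ Finset.range (q + 1), C i, fun a i => ?_⟩
  induction i using Nat.strong_induction_on with
  | _ i ih =>
    by_cases hi : i < q + 1
    · obtain ⟨a', k', -, h⟩ := hC i (∑ i ∈ Finset.range (q + 1), C i)
        (Finset.single_le_sum (f := C) (fun _ _ => Nat.zero_le _) (Finset.mem_range.2 hi)) a
      exact ⟨a', k', h⟩
    · obtain ⟨m, rfl⟩ : ∃ m, i = m + (q + 1) := ⟨i - (q + 1), by omega⟩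
      obtain ⟨a', k', h⟩ := ih m (by omega)
      refine ⟨a' + p * n ^ k', k', fun x hx => ?_⟩
      rw [Function.iterate_add_apply, hq, iter_add_int hF, h x hx, phi_add n hn]

lemma iter_eq_add {G : ℝ → ℝ} (hG : StrictMono G) (h1 : ∀ x (z : ℤ), G (x + z) = G x + z)
    (h : ∀ x, ∃ m : ℤ, G x = x + m) : ∃ p : ℤ, ∀ x, G x = x + p := by
  obtain ⟨p, hp⟩ := h 0
  refine ⟨p, fun x => ?_⟩
  have e : G x = G (Int.fract x) + ⌊x⌋ := by
    rw [← h1, Int.fract_add_floor]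
  obtain ⟨m, hm⟩ := h (Int.fract x)
  have a1 := hG.monotone (Int.fract_nonneg x)
  have a2 := hG (Int.fract_lt_one x)
  have a3 := h1 0 1
  simp at a3 hp
  rw [a3, hp, hm] at a2
  rw [hp, hm] at a1
  have b1 := Int.fract_nonneg x
  have b2 := Int.fract_lt_one x
  have c1 : (p : ℝ) < ((m + 1 : ℤ) : ℝ) := by push_cast; linarith
  have c2 : (m : ℝ) < ((p + 1 : ℤ) : ℝ) := by push_cast; linarith
  have : m = p := by
    have := Int.cast_lt.1 c1
    have := Int.cast_lt.1 c2
    omega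
  subst this
  rw [e, hm]
  have := Int.fract_add_floor x
  linarith

lemma floor_child {n : ℕ} (hn : 2 ≤ n) (v : ℝ) (k : ℕ) :
    ∃ j : ℕ, j < n ∧ ⌊v * n ^ (k + 1)⌋ = n * ⌊v * (n : ℝ) ^ k⌋ + j := by
  have hn0 : (0 : ℝ) < n := by positivity
  set a := ⌊v * (n : ℝ) ^ k⌋ with ha
  set b := ⌊v * (n : ℝ) ^ (k + 1)⌋ with hb
  have h1 := Int.floor_le (v * (n : ℝ) ^ k)
  have h2 := Int.lt_floor_add_one (v * (n : ℝ) ^ k)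
  have h3 : (n : ℤ) * a ≤ b := by
    rw [hb, Int.le_floor]
    push_cast
    rw [pow_succ, ← mul_assoc, mul_comm]
    exact mul_le_mul_of_nonneg_right h1 hn0.le
  have h4 : b < n * a + n := by
    rw [hb, Int.floor_lt]
    push_cast
    rw [pow_succ, ← mul_assoc]
    have := mul_lt_mul_of_pos_right h2 hn0
    rw [← ha] at this
    linarith
  exact ⟨(b - n * a).toNat, by omega, by omega⟩

lemma top_unique {n : ℕ} (hn : 2 ≤ n) {F : ℝ → ℝ} (v : ℝ) {k k' : ℕ}
    (hg : Good n F ⌊v * (n : ℝ) ^ k⌋ k) (hp : NoPar n F ⌊v * (n : ℝ) ^ k'⌋ k') : k' ≤ k := by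
  by_contra hlt
  push Not at hlt
  have up : ∀ m, k ≤ m → Good n F ⌊v * (n : ℝ) ^ m⌋ m := by
    intro m hm
    induction m, hm using Nat.le_induction with
    | base => exact hg
    | succ m _ ih =>
      obtain ⟨j, hj, e⟩ := floor_child hn v m
      rw [e]; exact ih.child hn j hj
  obtain ⟨m, rfl⟩ : ∃ m, k' = m + 1 := ⟨k' - 1, by omega⟩
  obtain ⟨j, hj, e⟩ := floor_child hn v m
  exact hp _ m j hj e rfl (up m (by omega))

lemma isNAdic_pow {n : ℕ} (hn : 2 ≤ n) {x : ℝ} (h : IsNAdic n x) :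
    ∃ M : ℕ, ∀ k, M ≤ k → ∃ a : ℤ, x * (n : ℝ) ^ k = a := by
  obtain ⟨a, M, rfl⟩ := h
  have hn0 : (0 : ℝ) < n := by positivity
  refine ⟨M, fun k hk => ⟨a * n ^ (k - M), ?_⟩⟩
  obtain ⟨d, rfl⟩ := Nat.exists_eq_add_of_le hk
  simp only [Nat.add_sub_cancel_left]
  push_cast
  rw [pow_add]
  field_simp

lemma isNAdic_of {n : ℕ} (hn : 2 ≤ n) {x : ℝ} {k : ℕ} {a : ℤ} (h : x * (n : ℝ) ^ k = a) :
    IsNAdic n x := by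
  have hn0 : (0 : ℝ) < n := by positivity
  exact ⟨a, k, by field_simp; linarith⟩

lemma isNAdic_sub {n : ℕ} (hn : 2 ≤ n) {x y : ℝ} (hx : IsNAdic n x) (hy : IsNAdic n y) :
    IsNAdic n (x - y) := by
  obtain ⟨M, hM⟩ := isNAdic_pow hn hx
  obtain ⟨N, hN⟩ := isNAdic_pow hn hy
  obtain ⟨a, ha⟩ := hM (M + N) (by omega)
  obtain ⟨b, hb⟩ := hN (M + N) (by omega)
  exact isNAdic_of hn (k := M + N) (a := a - b) (by push_cast; linarith)

lemma isNAdic_zpow_mul {n : ℕ} (hn : 2 ≤ n) {x : ℝ} (hx : IsNAdic n x) (s : ℤ) :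
    IsNAdic n ((n : ℝ) ^ s * x) := by
  have hn0 : (0 : ℝ) < n := by positivity
  obtain ⟨a, k, rfl⟩ := hx
  obtain ⟨m, rfl | rfl⟩ := s.eq_nat_or_neg
  · exact ⟨n ^ m * a, k, by push_cast; simp; ring⟩
  · refine ⟨a, m + k, ?_⟩
    rw [zpow_neg, zpow_natCast, pow_add]
    field_simp

lemma exists_piece (t : ℕ → ℝ) (m : ℕ) (x : ℝ) (h0 : t 0 ≤ x) (hm : x < t m) :
    ∃ i < m, t i ≤ x ∧ x < t (i + 1) := by
  induction m with
  | zero => exact absurd hm (not_lt.2 h0)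
  | succ m ih =>
    by_cases h : x < t m
    · obtain ⟨i, hi, h'⟩ := ih h
      exact ⟨i, by omega, h'⟩
    · exact ⟨m, by omega, not_lt.1 h, hm⟩

lemma deep_of_pieces {n : ℕ} (hn : 2 ≤ n) {F : ℝ → ℝ} (hF : ∀ x, F (x + 1) = F x + 1)
    (hN : ∀ x, IsNAdic n x → IsNAdic n (F x))
    (m : ℕ) (t : ℕ → ℝ) (slope : ℕ → ℤ) (c : ℕ → ℝ)
    (t0 : t 0 = 0) (tm : t m = 1) (tlt : ∀ i, i < m → t i < t (i + 1))
    (tn : ∀ i, i ≤ m → IsNAdic n (t i))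
    (tF : ∀ i, i < m → ∀ x ∈ Set.Icc (t i) (t (i + 1)),
      F x = (n : ℝ) ^ (slope i) * x + c i) : Deep n F := by
  have hn0 : (0 : ℝ) < n := by positivity
  have cn : ∀ i, i < m → IsNAdic n (c i) := by
    intro i hi
    have := tF i hi (t i) ⟨le_rfl, (tlt i hi).le⟩
    have e : c i = F (t i) - (n : ℝ) ^ (slope i) * t i := by linarith
    rw [e]
    exact isNAdic_sub hn (hN _ (tn i hi.le)) (isNAdic_zpow_mul hn (tn i hi.le) _)
  have hM : ∀ i, ∃ M : ℕ, i ≤ m → ∀ k, M ≤ k → ∃ a : ℤ, t i * (n : ℝ) ^ k = a := by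
    intro i
    by_cases hi : i ≤ m
    · obtain ⟨M, h⟩ := isNAdic_pow hn (tn i hi)
      exact ⟨M, fun _ => h⟩
    · exact ⟨0, fun h => absurd h hi⟩
  have hN' : ∀ i, ∃ M : ℕ, i < m → ∀ k, M ≤ k → ∃ a : ℤ, c i * (n : ℝ) ^ k = a := by
    intro i
    by_cases hi : i < m
    · obtain ⟨M, h⟩ := isNAdic_pow hn (cn i hi)
      exact ⟨M, fun _ => h⟩
    · exact ⟨0, fun h => absurd h hi⟩
  choose M hM using hM
  choose N hN' using hN'
  set C := ∑ i ∈ Finset.range (m + 1), (M i + N i + (slope i).natAbs) with hC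
  have hCi : ∀ i, i ≤ m → M i + N i + (slope i).natAbs ≤ C := fun i hi =>
    Finset.single_le_sum (f := fun i => M i + N i + (slope i).natAbs)
      (fun _ _ => Nat.zero_le _) (Finset.mem_range.2 (by omega))
  refine ⟨C, fun k hk a => ?_⟩
  have hpk : (0 : ℤ) < (n : ℤ) ^ k := by positivity
  have hpkR : (0 : ℝ) < (n : ℝ) ^ k := by positivity
  set z := a / (n : ℤ) ^ k with hz
  set a0 := a % (n : ℤ) ^ k with ha0
  have hdecomp : a = a0 + z * n ^ k := by
    rw [ha0, hz, mul_comm]; exact (Int.emod_add_mul_ediv a _).symm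
  have h0 : 0 ≤ a0 := Int.emod_nonneg _ hpk.ne'
  have h1 : a0 < (n : ℤ) ^ k := Int.emod_lt_of_pos _ hpk
  have h0R : (0 : ℝ) ≤ a0 := by exact_mod_cast h0
  have h1R : (a0 : ℝ) < (n : ℝ) ^ k := by exact_mod_cast h1
  obtain ⟨i, hi, hl, hr⟩ := exists_piece t m ((a0 : ℝ) / (n : ℝ) ^ k)
    (by rw [t0]; positivity) (by rw [tm, div_lt_one hpkR]; exact h1R)
  have hCi1 := hCi i hi.le
  have hCi2 := hCi (i + 1) hi
  obtain ⟨u, hu⟩ := hM (i + 1) hi k (by omega)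
  have hr' : (a0 : ℝ) + 1 ≤ t (i + 1) * (n : ℝ) ^ k := by
    rw [div_lt_iff₀ hpkR, hu] at hr
    rw [hu]
    have := Int.cast_lt.1 hr
    exact_mod_cast this
  set k' := ((k : ℤ) - slope i).toNat with hk'
  have hk'e : (k' : ℤ) = k - slope i := by omega
  obtain ⟨e, he⟩ := hN' i hi k' (by omega)
  have hrel : Rel n F a0 k (a0 + e) k' := by
    intro x hx
    obtain ⟨hx0, hx1⟩ := hx
    rw [tF i hi]
    · have hpk' : (0 : ℝ) < (n : ℝ) ^ k' := by positivity
      have hs : (n : ℝ) ^ (slope i) = (n : ℝ) ^ k / (n : ℝ) ^ k' := by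
        have : slope i = (k : ℤ) - k' := by omega
        rw [this, zpow_sub₀ hn0.ne', zpow_natCast, zpow_natCast]
      unfold phi
      rw [hs]
      push_cast
      rw [← he]
      field_simp
      ring
    · unfold phi
      refine ⟨hl.trans ?_, ?_⟩
      · gcongr; linarith
      · rw [div_le_iff₀ hpkR]; linarith
  refine ⟨a0 + e + z * n ^ k', k', by omega, ?_⟩
  rw [hdecomp]
  exact Rel.add (i := 1) hn hF hrel z

lemma exists_next (P : Finset ℝ) (a : ℝ) (ha : a < 1) : ∃ b, IsNext P a b := by
  have hne : ((insert (1 : ℝ) P).filter (a < ·)).Nonempty := ⟨1, by simp [ha]⟩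
  refine ⟨((insert (1 : ℝ) P).filter (a < ·)).min' hne, ?_, ?_,
    fun c hc hac => Finset.min'_le _ c (Finset.mem_filter.2 ⟨hc, hac⟩)⟩
  · exact (Finset.mem_filter.1 (Finset.min'_mem _ hne)).1
  · exact (Finset.mem_filter.1 (Finset.min'_mem _ hne)).2

/-- The invariant of the subdivision process. -/
def Inv (n : ℕ) (F : ℝ → ℝ) (K : ℕ) (P : Finset ℝ) : Prop :=
  (∃ k, IsStdSubdiv n k P) ∧ (0 : ℝ) ∈ P ∧ (∀ a ∈ P, 0 ≤ a ∧ a < 1) ∧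
  ∀ a ∈ P, ∀ b, IsNext P a b → ∃ (u : ℤ) (k : ℕ), k ≤ K ∧ phi n u k 0 = a ∧ phi n u k 1 = b ∧
    NoPar n F u k

lemma inv_base (n : ℕ) (F : ℝ → ℝ) (K : ℕ) : Inv n F K {0} := by
  refine ⟨⟨0, .base⟩, by simp, by simp, ?_⟩
  intro a ha b hb
  simp at ha
  subst ha
  obtain ⟨h1, h2, h3⟩ := hb
  simp at h1
  have : b = 1 := by
    rcases h1 with h | h
    · exact h
    · linarith
  subst this
  refine ⟨0, 0, by omega, by simp [phi], by simp [phi], ?_⟩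
  intro a0 k0 j _ _ h
  omega

lemma inv_step {n : ℕ} (hn : 2 ≤ n) {F : ℝ → ℝ} {K : ℕ} (hK : ∀ a, Good n F a K)
    {P : Finset ℝ} (hP : Inv n F K P) {a b : ℝ} (ha : a ∈ P) (hab : IsNext P a b)
    {u : ℤ} {k : ℕ} (hk : k ≤ K) (hu0 : phi n u k 0 = a) (hu1 : phi n u k 1 = b)
    (hng : ¬ Good n F u k) : ∃ P', Inv n F K P' ∧ P.card < P'.card := by
  have hn0 : (0 : ℝ) < n := by positivity
  obtain ⟨⟨l, hl⟩, hP0, hP1, hPc⟩ := hP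
  obtain ⟨hb, hlt, hmin⟩ := hab
  have hkK : k < K := by
    rcases hk.lt_or_eq with h | rfl
    · exact h
    · exact absurd (hK u) hng
  have hb1 : b ≤ 1 := hmin 1 (by simp) (hP1 a ha).2
  set g : ℕ → ℝ := fun j => a + j * (b - a) / n with hg
  have hgm : ∀ i j : ℕ, i < j → g i < g j := by
    intro i j hij
    have : (i : ℝ) < j := by exact_mod_cast hij
    simp only [hg]
    have : 0 < b - a := by linarith
    gcongr
  have hgle : ∀ i j : ℕ, g i < g j → i + 1 ≤ j := by
    intro i j hij
    by_contra h
    rcases (show j ≤ i by omega).lt_or_eq with h | rfl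
    · exact absurd (hgm _ _ h) (not_lt.2 hij.le)
    · exact lt_irrefl _ hij
  have hgm' : ∀ i j : ℕ, i ≤ j → g i ≤ g j := by
    intro i j hij
    rcases hij.lt_or_eq with h | rfl
    · exact (hgm _ _ h).le
    · rfl
  have g0 : g 0 = a := by simp [hg]
  have gn : g n = b := by simp only [hg]; field_simp; ring
  set P' := P ∪ (Finset.range n).image g with hP'
  have hmem : ∀ x, x ∈ P' ↔ x ∈ P ∨ ∃ j < n, g j = x := by
    intro x; simp [hP']
  have hsub : ∀ x, x ∈ insert (1 : ℝ) P → x ∈ insert (1 : ℝ) P' := by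
    intro x hx
    rw [Finset.mem_insert] at hx ⊢
    rw [hmem]
    tauto
  have gphi : ∀ j : ℕ, phi n (n * u + j) (k + 1) 0 = g j ∧
      phi n (n * u + j) (k + 1) 1 = g (j + 1) := by
    intro j
    rw [phi_child n hn, phi_child n hn]
    simp only [hg, ← hu0, ← hu1]
    unfold phi
    push_cast
    constructor <;> field_simp <;> ring
  refine ⟨P', ⟨⟨l + 1, .step l P a b hl ha hb hlt hmin⟩, (hmem _).2 (Or.inl hP0), ?_, ?_⟩, ?_⟩
  · intro x hx
    rcases (hmem x).1 hx with h | ⟨j, hj, rfl⟩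
    · exact hP1 x h
    · have h1 := hgm' 0 j (by omega)
      have h2 := hgm j n hj
      have := (hP1 a ha).1
      constructor <;> linarith
  · intro x hx y ⟨hy, hxy, hymin⟩
    by_cases hxg : ∃ j < n, g j = x
    · obtain ⟨j, hj, rfl⟩ := hxg
      have hz : g (j + 1) ∈ insert (1 : ℝ) P' := by
        rcases (show j + 1 ≤ n by omega).lt_or_eq with h | h
        · exact Finset.mem_insert_of_mem ((hmem _).2 (Or.inr ⟨_, h, rfl⟩))
        · rw [h, gn]; exact hsub b hb
      have hy1 := hymin _ hz (hgm _ _ (by omega))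
      have hy2 : g (j + 1) ≤ y := by
        have hbig : y ∈ insert (1 : ℝ) P → g (j + 1) ≤ y := by
          intro h
          have h1 := hgm' 0 j (by omega)
          have h2 := hmin y h (by linarith)
          have h3 := hgm' (j + 1) n (by omega)
          linarith
        rcases Finset.mem_insert.1 hy with h | h
        · exact hbig (Finset.mem_insert.2 (Or.inl h))
        · rcases (hmem _).1 h with h | ⟨i, hi, rfl⟩
          · exact hbig (Finset.mem_insert.2 (Or.inr h))
          · exact hgm' _ _ (hgle _ _ hxy)
      have hyz : y = g (j + 1) := le_antisymm hy1 hy2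
      refine ⟨n * u + j, k + 1, by omega, (gphi j).1, by rw [hyz]; exact (gphi j).2, ?_⟩
      intro a0 k0 i hi e ek
      have ek' : k0 = k := by omega
      subst ek'
      have : a0 = u := by
        have hd : ∀ (w : ℤ) (r : ℕ), r < n → ((n : ℤ) * w + r) / n = w := by
          intro w r hr
          rw [add_comm, Int.add_mul_ediv_left _ _ (by omega), Int.ediv_eq_zero_of_lt] <;> omega
        rw [← hd a0 i hi, ← e, hd u j hj]
      rw [this]; exact hng
    · have hxP : x ∈ P := by
        rcases (hmem x).1 hx with h | h
        · exact h
        · exact absurd h hxg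
      have hxa : x ≠ a := by
        rintro rfl; exact hxg ⟨0, by omega, g0⟩
      refine hPc x hxP y ⟨?_, hxy, fun c hc => hymin c (hsub c hc)⟩
      rcases Finset.mem_insert.1 hy with h | h
      · simp [h]
      rcases (hmem _).1 h with h | ⟨i, hi, rfl⟩
      · simp [h]
      rcases Nat.eq_zero_or_pos i with rfl | hipos
      · rw [g0]; simp [ha]
      exfalso
      have h1 := hgm 0 i hipos
      have h2 := hgm i n hi
      rcases lt_or_gt_of_ne hxa with h | h
      · have := hymin a (hsub a (by simp [ha])) h
        linarith
      · have := hmin x (by simp [hxP]) h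
        linarith
  · apply Finset.card_lt_card
    rw [Finset.ssubset_iff]
    refine ⟨g 1, ?_, ?_⟩
    · intro h
      have h1 := hgm 0 1 (by omega)
      have h2 := hgm 1 n (by omega)
      have := hmin (g 1) (by simp [h]) (by linarith)
      linarith
    · intro x hx
      rw [hmem]
      rcases Finset.mem_insert.1 hx with rfl | h
      · exact Or.inr ⟨1, by omega, rfl⟩
      · exact Or.inl h

lemma inv_card {n : ℕ} (hn : 2 ≤ n) {F : ℝ → ℝ} {K : ℕ} {P : Finset ℝ} (hP : Inv n F K P) :
    P.card ≤ n ^ K := by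
  have hn0 : (0 : ℝ) < n := by positivity
  obtain ⟨-, -, hP1, hPc⟩ := hP
  have : P ⊆ (Finset.range (n ^ K)).image (fun j : ℕ => (j : ℝ) / (n : ℝ) ^ K) := by
    intro a ha
    obtain ⟨h0, h1⟩ := hP1 a ha
    obtain ⟨b, hb⟩ := exists_next P a h1
    obtain ⟨u, k, hk, hu, -, -⟩ := hPc a ha b hb
    obtain ⟨d, rfl⟩ := Nat.exists_eq_add_of_le hk
    unfold phi at hu
    rw [add_zero] at hu
    rw [← hu] at h0 h1
    have hpk : (0 : ℝ) < (n : ℝ) ^ k := by positivity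
    rw [div_lt_one hpk] at h1
    have hu0 : (0 : ℝ) ≤ u := by
      by_contra h
      have := div_neg_of_neg_of_pos (not_le.1 h) hpk
      linarith
    have hu0' : 0 ≤ u := by exact_mod_cast hu0
    obtain ⟨w, rfl⟩ := Int.eq_ofNat_of_zero_le hu0'
    have hw : w < n ^ k := by exact_mod_cast h1
    rw [Finset.mem_image]
    refine ⟨w * n ^ d, ?_, ?_⟩
    · rw [Finset.mem_range, pow_add]
      exact Nat.mul_lt_mul_of_pos_right hw (by positivity)
    · rw [← hu]
      push_cast
      rw [pow_add]
      field_simp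
  calc P.card ≤ _ := Finset.card_le_card this
    _ ≤ (Finset.range (n ^ K)).card := Finset.card_image_le
    _ = n ^ K := Finset.card_range _

lemma exists_final {n : ℕ} (hn : 2 ≤ n) {F : ℝ → ℝ} {K : ℕ} (hK : ∀ a, Good n F a K) :
    ∃ P, Inv n F K P ∧ ∀ a ∈ P, ∀ b, IsNext P a b → ∃ (u : ℤ) (k : ℕ),
      phi n u k 0 = a ∧ phi n u k 1 = b ∧ NoPar n F u k ∧ Good n F u k := by
  by_contra hcon
  have big : ∀ N : ℕ, ∃ P, Inv n F K P ∧ N ≤ P.card := by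
    intro N
    induction N with
    | zero => exact ⟨_, inv_base n F K, by simp⟩
    | succ N ih =>
      obtain ⟨P, hP, hc⟩ := ih
      have h : ¬ ∀ a ∈ P, ∀ b, IsNext P a b → ∃ (u : ℤ) (k : ℕ),
          phi n u k 0 = a ∧ phi n u k 1 = b ∧ NoPar n F u k ∧ Good n F u k :=
        fun h => hcon ⟨P, hP, h⟩
      push Not at h
      obtain ⟨a, ha, b, hb, h⟩ := h
      obtain ⟨u, k, hk, h0, h1, hp⟩ := hP.2.2.2 a ha b hb
      obtain ⟨P', hP', hc'⟩ := inv_step hn hK hP ha hb hk h0 h1 (h u k h0 h1 hp)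
      exact ⟨P', hP', by omega⟩
  obtain ⟨P, hP, hc⟩ := big (n ^ K + 1)
  have := inv_card hn hP
  omega

lemma floor_of_mem {n : ℕ} (hn : 2 ≤ n) {u : ℤ} {k : ℕ} {v : ℝ} (h0 : phi n u k 0 ≤ v)
    (h1 : v < phi n u k 1) : ⌊v * (n : ℝ) ^ k⌋ = u := by
  have hpk : (0 : ℝ) < (n : ℝ) ^ k := by positivity
  unfold phi at h0 h1
  rw [div_le_iff₀ hpk] at h0
  rw [lt_div_iff₀ hpk] at h1
  rw [Int.floor_eq_iff]
  constructor <;> linarith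

lemma top_mem {n : ℕ} (hn : 2 ≤ n) {F : ℝ → ℝ} {P : Finset ℝ} (hP0 : (0 : ℝ) ∈ P)
    (hP : ∀ a ∈ P, ∀ b, IsNext P a b → ∃ (u : ℤ) (k : ℕ),
      phi n u k 0 = a ∧ phi n u k 1 = b ∧ NoPar n F u k ∧ Good n F u k)
    {w : ℤ} {l : ℕ} (hg : Good n F w l) (hp : NoPar n F w l)
    (h0 : 0 ≤ phi n w l 0) (h1 : phi n w l 0 < 1) : phi n w l 0 ∈ P := by
  set v := phi n w l 0 with hv
  have hne : (P.filter (· ≤ v)).Nonempty := ⟨0, by simp [hP0, h0]⟩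
  set a := (P.filter (· ≤ v)).max' hne with ha
  obtain ⟨haP, hav⟩ := Finset.mem_filter.1 (Finset.max'_mem _ hne)
  obtain ⟨b, hb⟩ := exists_next P a (lt_of_le_of_lt hav h1)
  have hvb : v < b := by
    by_contra h
    push Not at h
    have hbP : b ∈ P := by
      rcases Finset.mem_insert.1 hb.1 with e | e
      · linarith
      · exact e
    have := Finset.le_max' (P.filter (· ≤ v)) b (Finset.mem_filter.2 ⟨hbP, h⟩)
    exact absurd hb.2.1 (not_lt.2 this)
  obtain ⟨u, k, hu0, hu1, hup, hug⟩ := hP a haP b hb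
  have e1 : ⌊v * (n : ℝ) ^ k⌋ = u := floor_of_mem hn (hu0.trans_le hav) (hu1 ▸ hvb)
  have e2 : ⌊v * (n : ℝ) ^ l⌋ = w := by
    apply floor_of_mem hn le_rfl
    unfold phi
    have : (0 : ℝ) < (n : ℝ) ^ l := by positivity
    gcongr
    norm_num
  have k1 : l ≤ k := top_unique hn v (by rw [e1]; exact hug) (by rw [e2]; exact hp)
  have k2 : k ≤ l := top_unique hn v (by rw [e2]; exact hg) (by rw [e1]; exact hup)
  have : k = l := le_antisymm k2 k1
  subst this
  have : u = w := by rw [← e1, e2]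
  subst this
  rw [hv, hu0]
  exact haP

lemma pow_apply_homeo {α : Type*} [TopologicalSpace α] (f : α ≃ₜ α) (i : ℕ) (x : α) :
    (f ^ i) x = f^[i] x := by
  induction i generalizing x with
  | zero => rfl
  | succ i ih =>
    rw [pow_succ, Function.iterate_succ_apply, ← ih]
    rfl


lemma coe_eq_iff (x y : ℝ) : ((x : ℝ) : Circle) = (y : Circle) ↔ ∃ z : ℤ, x = y + z := by
  have h : ((x : ℝ) : Circle) = (y : Circle) ↔ ((x - y : ℝ) : Circle) = 0 := by
    rw [AddCircle.coe_sub, sub_eq_zero]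
  rw [h, AddCircle.coe_eq_zero_iff]
  constructor
  · rintro ⟨z, hz⟩
    exact ⟨z, by simp at hz; linarith⟩
  · rintro ⟨z, hz⟩
    exact ⟨z, by simp; linarith⟩

/-- Let `n ≥ 2` and let `f ∈ T_n` be an element of finite order.  Then
there exists a standard `n`-adic subdivision `P` of the circle `ℝ/ℤ` such that `f` maps
the set of endpoints of the intervals of `P` bijectively onto itself and `f` is affine on
each interval of `P`. -/
theorem torsion_preserves_a_subdivision (n : ℕ) (hn : 2 ≤ n)
    (f : Circle ≃ₜ Circle) (hf : f ∈ TnSet n) (hfin : IsOfFinOrder f) :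
    ∃ k : ℕ, ∃ P : Finset ℝ, IsStdSubdiv n k P ∧
      f '' circlePts P = circlePts P ∧ AffineOnParts P f := by
  obtain ⟨hfn, F, hmono, hlift, hF, m, t, slope, c, -, t0, tm, tlt, tn, tF⟩ := hf
  have hN : ∀ x, IsNAdic n x → IsNAdic n (F x) := by
    intro x hx
    have : f (x : Circle) ∈ nAdicPoints n := by
      rw [← hfn]; exact ⟨_, ⟨x, hx, rfl⟩, rfl⟩
    obtain ⟨y, hy, e⟩ := this
    rw [hlift, coe_eq_iff] at e
    obtain ⟨z, hz⟩ := e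
    have hz' : IsNAdic n ((-z : ℤ) : ℝ) := ⟨-z, 0, by simp⟩
    have := isNAdic_sub hn hy hz'
    rw [hz]
    convert this using 1
    push_cast; ring
  have hD : Deep n F := deep_of_pieces hn hF hN m t slope c t0 tm tlt tn tF
  obtain ⟨q', hq'pos, hq'⟩ := isOfFinOrder_iff_pow_eq_one.1 hfin
  obtain ⟨q, rfl⟩ : ∃ q, q' = q + 1 := ⟨q' - 1, by omega⟩
  have hiter : ∀ (i : ℕ) (x : ℝ), f^[i] (x : Circle) = ((F^[i] x : ℝ) : Circle) := by
    intro i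
    induction i with
    | zero => intro x; rfl
    | succ i ih =>
      intro x
      rw [Function.iterate_succ_apply, hlift, ih, Function.iterate_succ_apply]
  obtain ⟨p, hp⟩ : ∃ p : ℤ, ∀ x, F^[q + 1] x = x + p := by
    apply iter_eq_add (hmono.iterate _) (fun x z => iter_add_int hF _ x z)
    intro x
    rw [← coe_eq_iff, ← hiter, ← pow_apply_homeo, hq']
    rfl
  obtain ⟨K, hK⟩ := exists_level hn hF hp hD
  obtain ⟨P, ⟨⟨k, hk⟩, hP0, hP1, -⟩, hP⟩ := exists_final hn hK
  refine ⟨k, P, hk, ?_, ?_⟩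
  · have hfinP : (circlePts P).Finite := P.finite_toSet.image _
    refine Set.eq_of_subset_of_ncard_le ?_ ?_ hfinP
    · rintro _ ⟨_, ⟨a, ha, rfl⟩, rfl⟩
      obtain ⟨b, hb⟩ := exists_next P a (hP1 a ha).2
      obtain ⟨u, l, hu0, hu1, hup, hug⟩ := hP a ha b hb
      obtain ⟨w, l', hr⟩ := hug 1
      have hg' := hug.image 1 hr
      have hp' : NoPar n F w l' := hup.image hn hF hp hr
      have hFa : F a = phi n w l' 0 := by
        rw [← hu0]; exact hr 0 (by simp)
      set z := ⌊phi n w l' 0⌋ with hz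
      have e : phi n (w + (-z) * n ^ l') l' 0 = Int.fract (phi n w l' 0) := by
        rw [phi_add n hn, hz]
        push_cast
        rw [← sub_eq_add_neg]
        exact Int.self_sub_floor _
      have hmem := top_mem hn hP0 hP (hg'.add hn hF (-z)) (hp'.add hn hF (-z))
        (by rw [e]; exact Int.fract_nonneg _) (by rw [e]; exact Int.fract_lt_one _)
      refine ⟨_, hmem, ?_⟩
      show ((phi n (w + (-z) * n ^ l') l' 0 : ℝ) : Circle) = f (a : Circle)
      rw [hlift, hFa, coe_eq_iff]
      exact ⟨-z, phi_add n hn _ _ _ _⟩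
    · rw [Set.ncard_image_of_injective _ f.injective]
  · intro a ha b hb
    obtain ⟨u, l, hu0, hu1, hup, hug⟩ := hP a ha b hb
    obtain ⟨w, l', hr⟩ := hug 1
    have hpl : (0 : ℝ) < (n : ℝ) ^ l := by positivity
    have hpl' : (0 : ℝ) < (n : ℝ) ^ l' := by positivity
    refine ⟨(n : ℝ) ^ l / (n : ℝ) ^ l', ((w : ℝ) - u) / (n : ℝ) ^ l', fun x hx => ?_⟩
    obtain ⟨hxa, hxb⟩ := hx
    rw [← hu0] at hxa
    rw [← hu1] at hxb
    unfold phi at hxa hxb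
    rw [div_le_iff₀ hpl] at hxa
    rw [le_div_iff₀ hpl] at hxb
    have hr' := hr (x * (n : ℝ) ^ l - u) ⟨by linarith, by linarith⟩
    have ex : phi n u l (x * (n : ℝ) ^ l - u) = x := by
      unfold phi
      field_simp
      ring
    rw [ex] at hr'
    rw [hlift]
    congr 1
    have hr'' : F x = phi n w l' (x * (n : ℝ) ^ l - u) := hr'
    rw [hr'']
    unfold phi
    field_simp
    ring

end ThompsonPaper
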